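/- Let X be a real normed space and let p ∈ [0,1]. Then for all nonzero x, y ∈ X, α_p[x,y] ≤ ((4 − 3p)/(2 − p)) · β_p[x,y]. -/

import Mathlib

open Filter

/-- The `p`-angular distance `α_p[x,y] = ‖ ‖x‖^(p-1) • x − ‖y‖^(p-1) • y ‖`. -/
noncomputable def alphaP {X : Type*} [NormedAddCommGroup X] [NormedSpace ℝ X]
    (p : ℝ) (x y : X) : ℝ :=
  ‖(‖x‖ ^ (p - 1)) • x - (‖y‖ ^ (p - 1)) • y‖

/-- The skew `p`-angular distance `β_p[x,y] = ‖ ‖y‖^(p-1) • x − ‖x‖^(p-1) • y ‖`. -/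
noncomputable def betaP {X : Type*} [NormedAddCommGroup X] [NormedSpace ℝ X]
    (p : ℝ) (x y : X) : ℝ :=
  ‖(‖y‖ ^ (p - 1)) • x - (‖x‖ ^ (p - 1)) • y‖

/-- The Maligranda–Rooin constant `MR_p(X)`. -/
noncomputable def MRconst (X : Type*) [NormedAddCommGroup X] [NormedSpace ℝ X]
    (p : ℝ) : ℝ :=
  sSup { r : ℝ | ∃ x y : X, x ≠ 0 ∧ y ≠ 0 ∧ betaP p x y ≠ 0 ∧
    r = alphaP p x y / betaP p x y }

theorem alphaP_comm {X : Type*} [NormedAddCommGroup X] [NormedSpace ℝ X]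
    (p : ℝ) (x y : X) : alphaP p x y = alphaP p y x :=
  norm_sub_rev _ _

theorem betaP_comm {X : Type*} [NormedAddCommGroup X] [NormedSpace ℝ X]
    (p : ℝ) (x y : X) : betaP p x y = betaP p y x :=
  norm_sub_rev _ _

/-- For `t ≥ 1` and `q ≥ 0`, a consequence of Bernoulli's inequality for `(t ^ (1 + q)) ^ r` with
`r = q / (1 + q)`. -/
theorem one_sub_rpow_neg_sq_le {t q : ℝ} (ht : 1 ≤ t) (hq : 0 ≤ q) :
    1 - (t ^ (-q)) ^ 2 ≤ 2 * q / (1 + q) * (t - t ^ (-q)) := by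
  have ht0 : 0 < t := by linarith
  have hq1 : 0 < 1 + q := by linarith
  have hs : 0 < t ^ q := Real.rpow_pos_of_pos ht0 q
  have hz : t ^ (1 + q) = t * t ^ q := by rw [Real.rpow_add ht0, Real.rpow_one]
  have hzr : (t ^ (1 + q)) ^ (q / (1 + q)) = t ^ q := by
    rw [← Real.rpow_mul ht0.le, mul_div_cancel₀ _ hq1.ne']
  have hbern : t ^ q ≤ 1 + q / (1 + q) * (t * t ^ q - 1) := by
    have h := rpow_one_add_le_one_add_mul_self (s := t ^ (1 + q) - 1) (p := q / (1 + q))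
      (by linarith [Real.rpow_nonneg ht0.le (1 + q)]) (by positivity)
      ((div_le_one hq1).2 (by linarith))
    rwa [add_sub_cancel, hzr, hz] at h
  rw [Real.rpow_neg ht0.le]
  generalize t ^ q = s at *
  have hmul : s * s⁻¹ = 1 := mul_inv_cancel₀ hs.ne'
  have hinv : 0 < s⁻¹ := inv_pos.2 hs
  have hamgm : 2 ≤ s + s⁻¹ := by nlinarith [sq_nonneg (s - 1)]
  have hmain : s - s⁻¹ ≤ 2 * (q / (1 + q) * (t * s - 1)) := by linarith
  calc 1 - s⁻¹ ^ 2 = s⁻¹ * (s - s⁻¹) := by rw [mul_sub, mul_comm, hmul, sq]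
    _ ≤ s⁻¹ * (2 * (q / (1 + q) * (t * s - 1))) := by gcongr
    _ = 2 * q / (1 + q) * (t - s⁻¹) := by field_simp

theorem alphaP_le_of_norm_le {X : Type*} [NormedAddCommGroup X] [NormedSpace ℝ X]
    {p : ℝ} (hp1 : p ≤ 1) {x y : X} (hx : x ≠ 0) (hxy : ‖x‖ ≤ ‖y‖) :
    alphaP p x y ≤ ((4 - 3 * p) / (2 - p)) * betaP p x y := by
  have ha : 0 < ‖x‖ := norm_pos_iff.2 hx
  have hb : 0 < ‖y‖ := ha.trans_le hxy
  have hp2 : 0 < 2 - p := by linarith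
  have hA : 0 < ‖x‖ ^ (p - 1) := Real.rpow_pos_of_pos ha _
  have hB : 0 < ‖y‖ ^ (p - 1) := Real.rpow_pos_of_pos hb _
  have hBA : ‖y‖ ^ (p - 1) ≤ ‖x‖ ^ (p - 1) :=
    Real.rpow_le_rpow_of_nonpos ha hxy (by linarith)
  have hscalar := one_sub_rpow_neg_sq_le ((one_le_div ha).2 hxy) (sub_nonneg.2 hp1)
  rw [neg_sub, Real.div_rpow hb.le ha.le, show 1 + (1 - p) = 2 - p by ring] at hscalar
  unfold alphaP betaP
  generalize ‖x‖ ^ (p - 1) = A at *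
  generalize ‖y‖ ^ (p - 1) = B at *
  have hK : 0 ≤ 2 * (1 - p) / (2 - p) := div_nonneg (by linarith) hp2.le
  have hlower : A * ‖y‖ - B * ‖x‖ ≤ ‖B • x - A • y‖ := by
    have h := norm_sub_norm_le (A • y) (B • x)
    rwa [norm_smul_of_nonneg hA.le, norm_smul_of_nonneg hB.le, norm_sub_rev] at h
  have hratio : B / A ≤ 1 := (div_le_one hA).2 hBA
  have hratio0 : 0 ≤ B / A := by positivity
  have hcoef : 0 ≤ A * (1 - (B / A) ^ 2) := by
    apply mul_nonneg hA.le
    nlinarith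
  have hdecomp : A • x - B • y =
      (B / A) • (B • x - A • y) + (A * (1 - (B / A) ^ 2)) • x := by
    match_scalars <;> field_simp <;> ring
  calc ‖A • x - B • y‖
      ≤ B / A * ‖B • x - A • y‖ + A * (1 - (B / A) ^ 2) * ‖x‖ := by
        rw [hdecomp]
        refine (norm_add_le _ _).trans_eq ?_
        rw [norm_smul_of_nonneg hratio0, norm_smul_of_nonneg hcoef]
    _ = B / A * ‖B • x - A • y‖ + A * ‖x‖ * (1 - (B / A) ^ 2) := by ring
    _ ≤ 1 * ‖B • x - A • y‖ +
          A * ‖x‖ * (2 * (1 - p) / (2 - p) * (‖y‖ / ‖x‖ - B / A)) := by gcongr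
    _ = ‖B • x - A • y‖ + 2 * (1 - p) / (2 - p) * (A * ‖y‖ - B * ‖x‖) := by
        field_simp
    _ ≤ ‖B • x - A • y‖ + 2 * (1 - p) / (2 - p) * ‖B • x - A • y‖ := by gcongr
    _ = (4 - 3 * p) / (2 - p) * ‖B • x - A • y‖ := by
        field_simp
        ring

theorem stmt7 (X : Type*) [NormedAddCommGroup X] [NormedSpace ℝ X]
    (p : ℝ) (hp0 : 0 ≤ p) (hp1 : p ≤ 1)
    (x y : X) (hx : x ≠ 0) (hy : y ≠ 0) :
    alphaP p x y ≤ ((4 - 3 * p) / (2 - p)) * betaP p x y := by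
  rcases le_total ‖x‖ ‖y‖ with h | h
  · exact alphaP_le_of_norm_le hp1 hx h
  · rw [alphaP_comm, betaP_comm]
    exact alphaP_le_of_norm_le hp1 hy h
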